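/- arXiv:1908.09643 — 2 statements merged into one kernel-verified Lean document; each statement's English description precedes it below -/
import Mathlib

section
/- Assume σ satisfies condition (4.1): T_{deg(a)⁻¹}(T_{deg(c)⁻¹}(σ^{bd}_{ac})) = T_{deg(b)⁻¹}(T_{deg(d)⁻¹}(σ^{bd}_{ac})) for all a,b,c,d ∈ X, and assume σ is rigid with witnesses x_{ab}, y_{ab} ∈ A_σ. Let S̄ : k⟨Gen⟩ → A_σ^op be the unique k-algebra homomorphism into the opposite algebra of A_σ determined on generators by S̄(l ⊗ l') = l' ⊗ l + I_σ for l, l' ∈ L, S̄(L_{ab}) = (L⁻¹)_{ab} + I_σ, and S̄((L⁻¹)_{ab}) = x_{ab} for a,b ∈ X. Then S̄(I_σ) = {0}. -/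
open scoped TensorProduct
open MulOpposite

noncomputable section

set_option linter.unusedSectionVars false

variable (k L X G : Type*) [CommRing k] [Ring L] [Algebra k L] [Fintype X]
  [DecidableEq X] [Group G]

/-- The set `Gen` of generators: the underlying set of `L ⊗[k] Lᵐᵒᵖ` together with two
families of formal symbols `L_{ab}` and `(L⁻¹)_{ab}` indexed by `X × X`. -/
abbrev Gen : Type _ := (L ⊗[k] Lᵐᵒᵖ) ⊕ (X × X) ⊕ (X × X)

/-- The generator of `k⟨Gen⟩` corresponding to `ξ ∈ L ⊗[k] Lᵐᵒᵖ`. -/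
def iT (ξ : L ⊗[k] Lᵐᵒᵖ) : FreeAlgebra k (Gen k L X) := FreeAlgebra.ι k (Sum.inl ξ)

/-- The generator `L_{ab}` of `k⟨Gen⟩`. -/
def iL (a b : X) : FreeAlgebra k (Gen k L X) := FreeAlgebra.ι k (Sum.inr (Sum.inl (a, b)))

/-- The generator `(L⁻¹)_{ab}` of `k⟨Gen⟩`. -/
def iLi (a b : X) : FreeAlgebra k (Gen k L X) := FreeAlgebra.ι k (Sum.inr (Sum.inr (a, b)))

/-- `f ⊗ 1_L ∈ L ⊗[k] Lᵐᵒᵖ`. -/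
def sE (f : L) : L ⊗[k] Lᵐᵒᵖ := f ⊗ₜ[k] (1 : Lᵐᵒᵖ)

/-- `1_L ⊗ f ∈ L ⊗[k] Lᵐᵒᵖ`. -/
def tE (f : L) : L ⊗[k] Lᵐᵒᵖ := (1 : L) ⊗ₜ[k] (op f)

variable (deg : X → G) (T : G → L ≃ₐ[k] L) (σ : X → X → X → X → L)

/-- The set of generators (i)–(v) of the two-sided ideal `I_σ`. -/
def relSet : Set (FreeAlgebra k (Gen k L X)) :=
  {w | (∃ ξ ξ' : L ⊗[k] Lᵐᵒᵖ, w = iT k L X ξ + iT k L X ξ' - iT k L X (ξ + ξ')) ∨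
    (∃ (c : k) (ξ : L ⊗[k] Lᵐᵒᵖ), w = c • iT k L X ξ - iT k L X (c • ξ)) ∨
    (∃ ξ ξ' : L ⊗[k] Lᵐᵒᵖ, w = iT k L X ξ * iT k L X ξ' - iT k L X (ξ * ξ')) ∨
    (∃ a b : X, w = (∑ c : X, iL k L X a c * iLi k L X c b) - if a = b then 1 else 0) ∨
    (∃ a b : X, w = (∑ c : X, iLi k L X a c * iL k L X c b) - if a = b then 1 else 0) ∨
    (∃ (f : L) (a b : X),
      w = iT k L X (sE k L (T (deg a) f)) * iL k L X a b - iL k L X a b * iT k L X (sE k L f)) ∨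
    (∃ (f : L) (a b : X),
      w = iT k L X (tE k L (T (deg b) f)) * iL k L X a b - iL k L X a b * iT k L X (tE k L f)) ∨
    (∃ (f : L) (a b : X),
      w = iT k L X (sE k L f) * iLi k L X a b - iLi k L X a b * iT k L X (sE k L (T (deg b) f))) ∨
    (∃ (f : L) (a b : X),
      w = iT k L X (tE k L f) * iLi k L X a b - iLi k L X a b * iT k L X (tE k L (T (deg a) f))) ∨
    (∃ a b c d : X,
      w = (∑ x : X, ∑ y : X, iT k L X (sE k L (σ x y a c)) * iL k L X y d * iL k L X x b) -
        ∑ x : X, ∑ y : X, iT k L X (tE k L (σ b d x y)) * iL k L X c y * iL k L X a x) ∨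
    w = 1 - iT k L X (1 : L ⊗[k] Lᵐᵒᵖ)}

/-- The two-sided ideal `I_σ` of `k⟨Gen⟩`. -/
def Isig : TwoSidedIdeal (FreeAlgebra k (Gen k L X)) :=
  TwoSidedIdeal.span (relSet k L X G deg T σ)

/-- The quotient algebra `A_σ = k⟨Gen⟩ / I_σ`. -/
def Asig : Type _ := (Isig k L X G deg T σ).ringCon.Quotient

instance : Ring (Asig k L X G deg T σ) :=
  inferInstanceAs (Ring (RingCon.Quotient _))

/-- The quotient map `k⟨Gen⟩ → A_σ`, `w ↦ w + I_σ`. -/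
def mkA : FreeAlgebra k (Gen k L X) →+* Asig k L X G deg T σ := RingCon.mk' _

instance : Algebra k (Asig k L X G deg T σ) :=
  RingHom.toAlgebra' ((mkA k L X G deg T σ).comp (algebraMap k (FreeAlgebra k (Gen k L X))))
    (by
      intro c x
      obtain ⟨y, rfl⟩ := Quotient.mk''_surjective (α := FreeAlgebra k (Gen k L X)) x
      show mkA k L X G deg T σ _ * mkA k L X G deg T σ y =
        mkA k L X G deg T σ y * mkA k L X G deg T σ _
      rw [← map_mul, ← map_mul, Algebra.commutes])


/-- The `k`-linear map `L ⊗[k] L^{op} → L ⊗[k] L^{op}`, `l ⊗ l' ↦ l' ⊗ l`. -/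
def swapT : (L ⊗[k] Lᵐᵒᵖ) →ₗ[k] (L ⊗[k] Lᵐᵒᵖ) :=
  TensorProduct.lift (LinearMap.mk₂ k (fun (l : L) (m : Lᵐᵒᵖ) => m.unop ⊗ₜ[k] op l)
    (fun l l' m => by simp [op_add, TensorProduct.tmul_add])
    (fun c l m => by simp [op_smul, TensorProduct.tmul_smul])
    (fun l m m' => by simp [unop_add, TensorProduct.add_tmul])
    (fun c l m => by simp [unop_smul, TensorProduct.smul_tmul']))

/-- The `k`-algebra homomorphism `S̄ : k⟨Gen⟩ → A_σ^{op}` determined by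
`S̄(l ⊗ l') = l' ⊗ l + I_σ`, `S̄(L_{ab}) = (L⁻¹)_{ab} + I_σ` and `S̄((L⁻¹)_{ab}) = x_{ab}`. -/
def Sbar (x : X → X → Asig k L X G deg T σ) :
    FreeAlgebra k (Gen k L X) →ₐ[k] (Asig k L X G deg T σ)ᵐᵒᵖ :=
  FreeAlgebra.lift k (fun g => match g with
    | Sum.inl ξ => op (mkA k L X G deg T σ (iT k L X (swapT k L ξ)))
    | Sum.inr (Sum.inl (a, b)) => op (mkA k L X G deg T σ (iLi k L X a b))
    | Sum.inr (Sum.inr (a, b)) => op (x a b))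

theorem mul_eq_mul_of_inverse {M : Type*} [Monoid M] {p q s t : M} (hpq : p * q = 1)
    (hqp : q * p = 1) (h : s * p = p * t) : q * s = t * q := by
  calc q * s = q * (s * p) * q := by simp only [mul_assoc, hpq, mul_one]
    _ = t * q := by rw [h, ← mul_assoc q p t, hqp, one_mul]

section Matrix

variable {ι R : Type*} [Fintype ι] [DecidableEq ι] [Ring R]

theorem intertwine_inverse {M N : Matrix ι ι R} (hMN : M * N = 1) (hNM : N * M = 1) {u v : ι → R}
    (h : ∀ i j, u i * M i j = M i j * v j) (i j : ι) : N i j * u j = v i * N i j := by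
  have hd : Matrix.diagonal u * M = M * Matrix.diagonal v := by
    ext i j
    simp [h]
  have key := mul_eq_mul_of_inverse hMN hNM hd
  simpa using congrFun₂ key i j

theorem pairMatrix_mul_pairMatrix {M N : Matrix ι ι R} (h : M * N = 1) :
    (Matrix.of fun p q : ι × ι => M p.2 q.2 * M p.1 q.1) *
      (Matrix.of fun p q : ι × ι => N p.1 q.1 * N p.2 q.2) = 1 := by
  have h' (i j : ι) : ∑ c, M i c * N c j = (1 : Matrix ι ι R) i j := by
    rw [← h, Matrix.mul_apply]
  ext ⟨a, c⟩ ⟨b, d⟩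
  calc _ = ∑ y, M c y * (∑ x, M a x * N x b) * N y d := by
        simp only [Matrix.mul_apply, Matrix.of_apply, Fintype.sum_prod_type_right, Finset.mul_sum,
          Finset.sum_mul, mul_assoc]
    _ = _ := by
        rw [h', Matrix.one_apply, Matrix.one_apply]
        by_cases hab : a = b <;> simp [hab, h', Matrix.one_apply]

theorem pairMatrix_mul_pairMatrix' {M N : Matrix ι ι R} (h : N * M = 1) :
    (Matrix.of fun p q : ι × ι => N p.1 q.1 * N p.2 q.2) *
      (Matrix.of fun p q : ι × ι => M p.2 q.2 * M p.1 q.1) = 1 := by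
  have h' (i j : ι) : ∑ c, N i c * M c j = (1 : Matrix ι ι R) i j := by
    rw [← h, Matrix.mul_apply]
  ext ⟨a, c⟩ ⟨b, d⟩
  calc _ = ∑ x, N a x * (∑ y, N c y * M y d) * M x b := by
        simp only [Matrix.mul_apply, Matrix.of_apply, Fintype.sum_prod_type, Finset.mul_sum,
          Finset.sum_mul, mul_assoc]
    _ = _ := by
        rw [h', Matrix.one_apply, Matrix.one_apply]
        by_cases hcd : c = d <;> simp [hcd, h', Matrix.one_apply]

theorem exchange_inverse {M N : Matrix ι ι R} (hMN : M * N = 1) (hNM : N * M = 1)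
    {s t : ι → ι → ι → ι → R}
    (h : ∀ a b c d, ∑ x, ∑ y, s x y a c * M y d * M x b = ∑ x, ∑ y, M c y * M a x * t b d x y)
    (a b c d : ι) :
    ∑ x, ∑ y, N a x * N c y * s b d x y = ∑ x, ∑ y, t x y a c * (N x b * N y d) := by
  have key := mul_eq_mul_of_inverse (pairMatrix_mul_pairMatrix hMN)
    (pairMatrix_mul_pairMatrix' hNM)
    (s := Matrix.of fun p q : ι × ι => s q.1 q.2 p.1 p.2)
    (t := Matrix.of fun p q : ι × ι => t q.1 q.2 p.1 p.2) (by
      ext ⟨a, c⟩ ⟨b, d⟩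
      simpa [Matrix.mul_apply, Fintype.sum_prod_type, mul_assoc] using h a b c d)
  simpa [Matrix.mul_apply, Fintype.sum_prod_type] using congrFun₂ key (a, c) (b, d)

end Matrix

section Quotient

theorem mkA_eq_zero {w : FreeAlgebra k (Gen k L X)} (hw : w ∈ relSet k L X G deg T σ) :
    mkA k L X G deg T σ w = 0 := by
  have h := TwoSidedIdeal.subset_span hw
  exact (RingCon.eq _).2 ((TwoSidedIdeal.mem_iff _ _).1 h)

theorem mkA_smul (c : k) (w : FreeAlgebra k (Gen k L X)) :
    mkA k L X G deg T σ (c • w) = c • mkA k L X G deg T σ w := by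
  rw [Algebra.smul_def, map_mul, Algebra.smul_def]
  rfl

theorem mkA_iT_add (ξ ξ' : L ⊗[k] Lᵐᵒᵖ) :
    mkA k L X G deg T σ (iT k L X (ξ + ξ')) =
      mkA k L X G deg T σ (iT k L X ξ) + mkA k L X G deg T σ (iT k L X ξ') := by
  rw [← map_add]
  refine (sub_eq_zero.1 ?_).symm
  rw [← map_sub]
  exact mkA_eq_zero k L X G deg T σ (Or.inl ⟨ξ, ξ', rfl⟩)

theorem mkA_iT_smul (c : k) (ξ : L ⊗[k] Lᵐᵒᵖ) :
    mkA k L X G deg T σ (iT k L X (c • ξ)) = c • mkA k L X G deg T σ (iT k L X ξ) := by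
  rw [← mkA_smul]
  refine (sub_eq_zero.1 ?_).symm
  rw [← map_sub]
  exact mkA_eq_zero k L X G deg T σ (Or.inr (Or.inl ⟨c, ξ, rfl⟩))

theorem mkA_iT_mul (ξ ξ' : L ⊗[k] Lᵐᵒᵖ) :
    mkA k L X G deg T σ (iT k L X (ξ * ξ')) =
      mkA k L X G deg T σ (iT k L X ξ) * mkA k L X G deg T σ (iT k L X ξ') := by
  rw [← map_mul]
  refine (sub_eq_zero.1 ?_).symm
  rw [← map_sub]
  exact mkA_eq_zero k L X G deg T σ (Or.inr (Or.inr (Or.inl ⟨ξ, ξ', rfl⟩)))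

theorem mkA_iT_one : mkA k L X G deg T σ (iT k L X 1) = 1 := by
  rw [← map_one (mkA k L X G deg T σ)]
  refine (sub_eq_zero.1 ?_).symm
  rw [← map_sub]
  exact mkA_eq_zero k L X G deg T σ (by simp [relSet])

theorem sum_mkA_iL_mul_iLi (a b : X) :
    ∑ c, mkA k L X G deg T σ (iL k L X a c) * mkA k L X G deg T σ (iLi k L X c b) =
      if a = b then 1 else 0 := by
  have h := mkA_eq_zero k L X G deg T σ
    (Or.inr (Or.inr (Or.inr (Or.inl ⟨a, b, rfl⟩))))
  simpa [sub_eq_zero, apply_ite (mkA k L X G deg T σ)] using h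

theorem sum_mkA_iLi_mul_iL (a b : X) :
    ∑ c, mkA k L X G deg T σ (iLi k L X a c) * mkA k L X G deg T σ (iL k L X c b) =
      if a = b then 1 else 0 := by
  have h := mkA_eq_zero k L X G deg T σ
    (Or.inr (Or.inr (Or.inr (Or.inr (Or.inl ⟨a, b, rfl⟩)))))
  simpa [sub_eq_zero, apply_ite (mkA k L X G deg T σ)] using h

theorem mkA_tE_mul_iL (f : L) (a b : X) :
    mkA k L X G deg T σ (iT k L X (tE k L (T (deg b) f))) * mkA k L X G deg T σ (iL k L X a b) =
      mkA k L X G deg T σ (iL k L X a b) * mkA k L X G deg T σ (iT k L X (tE k L f)) := by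
  have h := mkA_eq_zero k L X G deg T σ
    (Or.inr (Or.inr (Or.inr (Or.inr (Or.inr (Or.inr (Or.inl ⟨f, a, b, rfl⟩)))))))
  simpa [sub_eq_zero] using h

theorem mkA_sE_mul_iLi (f : L) (a b : X) :
    mkA k L X G deg T σ (iT k L X (sE k L f)) * mkA k L X G deg T σ (iLi k L X a b) =
      mkA k L X G deg T σ (iLi k L X a b) *
        mkA k L X G deg T σ (iT k L X (sE k L (T (deg b) f))) := by
  have h := mkA_eq_zero k L X G deg T σ
    (Or.inr (Or.inr (Or.inr (Or.inr (Or.inr (Or.inr (Or.inr (Or.inl ⟨f, a, b, rfl⟩))))))))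
  simpa [sub_eq_zero] using h

theorem mkA_tE_mul_iLi (f : L) (a b : X) :
    mkA k L X G deg T σ (iT k L X (tE k L f)) * mkA k L X G deg T σ (iLi k L X a b) =
      mkA k L X G deg T σ (iLi k L X a b) *
        mkA k L X G deg T σ (iT k L X (tE k L (T (deg a) f))) := by
  have h := mkA_eq_zero k L X G deg T σ
    (Or.inr (Or.inr (Or.inr (Or.inr (Or.inr (Or.inr (Or.inr (Or.inr (Or.inl
      ⟨f, a, b, rfl⟩)))))))))
  simpa [sub_eq_zero] using h

theorem mkA_exchange (a b c d : X) :
    ∑ x, ∑ y, mkA k L X G deg T σ (iT k L X (sE k L (σ x y a c))) *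
        mkA k L X G deg T σ (iL k L X y d) * mkA k L X G deg T σ (iL k L X x b) =
      ∑ x, ∑ y, mkA k L X G deg T σ (iT k L X (tE k L (σ b d x y))) *
        mkA k L X G deg T σ (iL k L X c y) * mkA k L X G deg T σ (iL k L X a x) := by
  have h := mkA_eq_zero k L X G deg T σ
    (Or.inr (Or.inr (Or.inr (Or.inr (Or.inr (Or.inr (Or.inr (Or.inr (Or.inr (Or.inl
      ⟨a, b, c, d, rfl⟩))))))))))
  simpa [sub_eq_zero] using h

theorem swapT_tmul (l : L) (m : Lᵐᵒᵖ) : swapT k L (l ⊗ₜ m) = m.unop ⊗ₜ op l :=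
  rfl

theorem swapT_mul (ξ ξ' : L ⊗[k] Lᵐᵒᵖ) :
    swapT k L (ξ * ξ') = swapT k L ξ' * swapT k L ξ := by
  induction ξ with
  | zero => simp
  | add ξ₁ ξ₂ h₁ h₂ => rw [add_mul, map_add, h₁, h₂, map_add, mul_add]
  | tmul l m =>
    induction ξ' with
    | zero => simp
    | add ξ₁ ξ₂ h₁ h₂ => rw [mul_add, map_add, h₁, h₂, map_add, add_mul]
    | tmul l' m' => simp [swapT_tmul]

theorem swapT_one : swapT k L 1 = 1 := by
  simp [swapT_tmul, Algebra.TensorProduct.one_def]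

theorem swapT_sE (f : L) : swapT k L (sE k L f) = tE k L f := by
  simp [swapT_tmul, sE, tE]

theorem swapT_tE (f : L) : swapT k L (tE k L f) = sE k L f := by
  simp [swapT_tmul, sE, tE]

variable (x : X → X → Asig k L X G deg T σ)

theorem Sbar_iT (ξ : L ⊗[k] Lᵐᵒᵖ) :
    Sbar k L X G deg T σ x (iT k L X ξ) = op (mkA k L X G deg T σ (iT k L X (swapT k L ξ))) :=
  FreeAlgebra.lift_ι_apply _ _

theorem Sbar_iL (a b : X) :
    Sbar k L X G deg T σ x (iL k L X a b) = op (mkA k L X G deg T σ (iLi k L X a b)) :=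
  FreeAlgebra.lift_ι_apply _ _

theorem Sbar_iLi (a b : X) : Sbar k L X G deg T σ x (iLi k L X a b) = op (x a b) :=
  FreeAlgebra.lift_ι_apply _ _

end Quotient


/-- If `σ` is rigid with witnesses `x`, `y`, then `S̄(I_σ) = {0}`. -/
theorem Sbar_Isig_eq_zero (hT : ∀ (α : G) (f : L), T α (T α⁻¹ f) = f)
    (h41 : ∀ a b c d : X,
      T (deg a)⁻¹ (T (deg c)⁻¹ (σ b d a c)) = T (deg b)⁻¹ (T (deg d)⁻¹ (σ b d a c)))
    (x y : X → X → Asig k L X G deg T σ)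
    (hx1 : ∀ a b : X,
      (∑ c : X, mkA k L X G deg T σ (iLi k L X c b) * x a c) = (if a = b then 1 else 0))
    (hx2 : ∀ a b : X,
      (∑ c : X, x c b * mkA k L X G deg T σ (iLi k L X a c)) = (if a = b then 1 else 0))
    (hy1 : ∀ a b : X,
      (∑ c : X, mkA k L X G deg T σ (iL k L X c b) * y a c) = (if a = b then 1 else 0))
    (hy2 : ∀ a b : X,
      (∑ c : X, y c b * mkA k L X G deg T σ (iL k L X a c)) = (if a = b then 1 else 0)) :
    ∀ w ∈ Isig k L X G deg T σ, Sbar k L X G deg T σ x w = 0 := by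
  have hT' (α : G) (f : L) : T α⁻¹ (T α f) = f := by simpa using hT α⁻¹ f
  set M : Matrix X X (Asig k L X G deg T σ) :=
    Matrix.of fun a b => mkA k L X G deg T σ (iL k L X a b) with hM
  set N : Matrix X X (Asig k L X G deg T σ) :=
    Matrix.of fun a b => mkA k L X G deg T σ (iLi k L X a b) with hN
  have hMN : M * N = 1 := by
    ext a b
    simpa [hM, hN, Matrix.mul_apply, Matrix.one_apply] using sum_mkA_iL_mul_iLi k L X G deg T σ a b
  have hNM : N * M = 1 := by
    ext a b
    simpa [hM, hN, Matrix.mul_apply, Matrix.one_apply] using sum_mkA_iLi_mul_iL k L X G deg T σ a b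
  have hNx : N.transpose * (Matrix.of x).transpose = 1 := by
    ext a b
    simpa [hN, Matrix.mul_apply, Matrix.one_apply, eq_comm (a := a)] using hx1 b a
  have hxN : (Matrix.of x).transpose * N.transpose = 1 := by
    ext a b
    simpa [hN, Matrix.mul_apply, Matrix.one_apply, eq_comm (a := a)] using hx2 b a
  have htx (f : L) (a b : X) : x a b * mkA k L X G deg T σ (iT k L X (tE k L f)) =
      mkA k L X G deg T σ (iT k L X (tE k L (T (deg b) f))) * x a b :=
    intertwine_inverse hNx hxN
      (u := fun _ => mkA k L X G deg T σ (iT k L X (tE k L f)))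
      (v := fun d => mkA k L X G deg T σ (iT k L X (tE k L (T (deg d) f))))
      (fun i j => mkA_tE_mul_iLi k L X G deg T σ f j i) b a
  have hsx (f : L) (a b : X) : x a b * mkA k L X G deg T σ (iT k L X (sE k L f)) =
      mkA k L X G deg T σ (iT k L X (sE k L (T (deg a) f))) * x a b := by
    have h := intertwine_inverse hNx hxN
      (u := fun c => mkA k L X G deg T σ (iT k L X (sE k L (T (deg c)⁻¹ (T (deg a) f)))))
      (v := fun _ => mkA k L X G deg T σ (iT k L X (sE k L (T (deg a) f))))
      (fun i j => by
        simpa [hN, hT] using mkA_sE_mul_iLi k L X G deg T σ (T (deg i)⁻¹ (T (deg a) f)) j i) b a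
    simpa [hT'] using h
  have htL (f : L) (a b : X) : mkA k L X G deg T σ (iT k L X (tE k L f)) * M a b =
      M a b * mkA k L X G deg T σ (iT k L X (tE k L (T (deg b)⁻¹ f))) := by
    simpa [hM, hT] using mkA_tE_mul_iL k L X G deg T σ (T (deg b)⁻¹ f) a b
  have htLi (f : L) (a b : X) :
      mkA k L X G deg T σ (iT k L X (tE k L (T (deg a)⁻¹ f))) * N a b =
        N a b * mkA k L X G deg T σ (iT k L X (tE k L f)) := by
    simpa [hN, hT] using mkA_tE_mul_iLi k L X G deg T σ (T (deg a)⁻¹ f) a b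
  have hexch := exchange_inverse hMN hNM
    (s := fun b d a c => mkA k L X G deg T σ (iT k L X (sE k L (σ b d a c))))
    (t := fun b d a c =>
      mkA k L X G deg T σ (iT k L X (tE k L (T (deg a)⁻¹ (T (deg c)⁻¹ (σ b d a c))))))
    (fun a b c d => by
      refine (mkA_exchange k L X G deg T σ a b c d).trans ?_
      refine Finset.sum_congr rfl fun i _ => Finset.sum_congr rfl fun j _ => ?_
      change _ * M c j * M a i = _
      rw [htL, mul_assoc, htL, mul_assoc])
  suffices h : Isig k L X G deg T σ ≤ TwoSidedIdeal.ker (Sbar k L X G deg T σ x) from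
    fun w hw => (TwoSidedIdeal.mem_ker _).1 (h hw)
  refine TwoSidedIdeal.span_le.2 fun w hw => (TwoSidedIdeal.mem_ker _).2 ?_
  rcases hw with ⟨ξ, ξ', rfl⟩ | ⟨c, ξ, rfl⟩ | ⟨ξ, ξ', rfl⟩ | ⟨a, b, rfl⟩ | ⟨a, b, rfl⟩ |
    ⟨f, a, b, rfl⟩ | ⟨f, a, b, rfl⟩ | ⟨f, a, b, rfl⟩ | ⟨f, a, b, rfl⟩ | ⟨a, b, c, d, rfl⟩ | rfl
  · simp only [map_sub, map_add, Sbar_iT, mkA_iT_add, op_add, sub_self]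
  · simp only [map_sub, map_smul, Sbar_iT, mkA_iT_smul, op_smul, sub_self]
  · simp only [map_sub, map_mul, Sbar_iT, swapT_mul, mkA_iT_mul, op_mul, sub_self]
  · simp only [map_sub, map_sum, map_mul, Sbar_iL, Sbar_iLi, ← op_mul, ← Finset.op_sum, hx2,
      apply_ite (Sbar k L X G deg T σ x), apply_ite op, map_one, map_zero, op_one, op_zero,
      sub_self]
  · simp only [map_sub, map_sum, map_mul, Sbar_iL, Sbar_iLi, ← op_mul, ← Finset.op_sum, hx1,
      apply_ite (Sbar k L X G deg T σ x), apply_ite op, map_one, map_zero, op_one, op_zero,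
      sub_self]
  · simp only [map_sub, map_mul, Sbar_iL, Sbar_iT, swapT_sE, ← op_mul, mkA_tE_mul_iLi, sub_self]
  · simp only [map_sub, map_mul, Sbar_iL, Sbar_iT, swapT_tE, ← op_mul, mkA_sE_mul_iLi, sub_self]
  · simp only [map_sub, map_mul, Sbar_iLi, Sbar_iT, swapT_sE, ← op_mul, htx, sub_self]
  · simp only [map_sub, map_mul, Sbar_iLi, Sbar_iT, swapT_tE, ← op_mul, hsx, sub_self]
  · simp only [map_sub, map_sum, map_mul, Sbar_iL, Sbar_iT, swapT_sE, swapT_tE, ← op_mul,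
      ← Finset.op_sum, ← op_sub]
    rw [op_eq_zero_iff, sub_eq_zero]
    refine Eq.trans ?_ ((hexch a b c d).symm.trans ?_)
    · refine Finset.sum_congr rfl fun i _ => Finset.sum_congr rfl fun j _ => Eq.symm ?_
      rw [h41, ← mul_assoc, htLi, mul_assoc, htLi]
      rfl
    · simp only [hN, Matrix.of_apply, mul_assoc]
  · simp only [map_sub, map_one, Sbar_iT, swapT_one, mkA_iT_one, op_one, sub_self]

end
end

section
/- Assume σ satisfies condition (4.1): T_{deg(a)⁻¹}(T_{deg(c)⁻¹}(σ^{bd}_{ac})) = T_{deg(b)⁻¹}(T_{deg(d)⁻¹}(σ^{bd}_{ac})) for all a,b,c,d ∈ X, and assume σ satisfies conditions (1)–(5). Then the elements y_{ab} := Σ_{c,d∈X} (Q'⁻¹_{db} ⊗ Q'_{ac})(L⁻¹)_{cd} + I_σ of A_σ satisfy, for all a,b ∈ X, Σ_{c∈X} (L_{cb} + I_σ)y_{ac} = δ_{ab}1_{A_σ} = Σ_{c∈X} y_{cb}(L_{ac} + I_σ). -/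
open scoped TensorProduct
open MulOpposite

noncomputable section

set_option linter.unusedSectionVars false

variable (k L X G : Type*) [CommRing k] [Ring L] [Algebra k L] [Fintype X]
  [DecidableEq X] [Group G]

variable (deg : X → G) (T : G → L ≃ₐ[k] L) (σ : X → X → X → X → L)

section ExchangeRelations

variable {R A : Type*} [Ring R] [Ring A] {I : Type*} [Fintype I] [DecidableEq I]
  {s : R →+* A} {t : Rᵐᵒᵖ →+* A} {S : I → R ≃+* R} {l m : I → I → A}
  {σ' τ i : I → I → I → I → R}

/-- The `RLL` relation, rewritten as an exchange relation between `m = l⁻¹` and `l`. Here `S a`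
is the automorphism attached to `a`, and `τ^{xy}_{ac}` is `S_c⁻¹ (σ'^{xy}_{ac})`. -/
theorem exchange_of_rll (hlm : ∀ a b, ∑ c, l a c * m c b = if a = b then 1 else 0)
    (hml : ∀ a b, ∑ c, m a c * l c b = if a = b then 1 else 0)
    (hsm : ∀ f a b, s f * m a b = m a b * s (S b f))
    (htm : ∀ f a b, t (op f) * m a b = m a b * t (op (S a f)))
    (hτ : ∀ x y a c, S c (τ x y a c) = σ' x y a c)
    (hrll : ∀ a b c d, (∑ p : I × I, s (σ' p.1 p.2 a c) * l p.2 d * l p.1 b) =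
      ∑ p : I × I, t (op (σ' b d p.1 p.2)) * l c p.2 * l a p.1) (a d e f : I) :
    (∑ p : I × I, s (τ f p.2 a p.1) * (m e p.1 * l p.2 d)) =
      ∑ p : I × I, t (op (τ p.2 d p.1 e)) * (l a p.1 * m p.2 f) := by
  have key : (∑ c, ∑ b, m e c * (∑ p : I × I, s (σ' p.1 p.2 a c) * l p.2 d * l p.1 b) * m b f) =
      ∑ b, ∑ c, m e c * (∑ p : I × I, t (op (σ' b d p.1 p.2)) * l c p.2 * l a p.1) * m b f := by
    rw [Finset.sum_comm]
    simp only [hrll]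
  have hleft (c : I) :
      (∑ b, m e c * (∑ p : I × I, s (σ' p.1 p.2 a c) * l p.2 d * l p.1 b) * m b f) =
        ∑ y, s (τ f y a c) * (m e c * l y d) := by
    simp only [Finset.mul_sum, Finset.sum_mul]
    rw [Finset.sum_comm]
    have (p : I × I) :
        (∑ b, m e c * (s (σ' p.1 p.2 a c) * l p.2 d * l p.1 b) * m b f) =
          s (τ p.1 p.2 a c) * (m e c * l p.2 d) * (if p.1 = f then 1 else 0) := by
      rw [← hlm, Finset.mul_sum]
      refine Finset.sum_congr rfl fun b _ => ?_
      rw [← mul_assoc (s (τ p.1 p.2 a c)), hsm, hτ]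
      simp only [mul_assoc]
    simp only [this, Fintype.sum_prod_type_right, mul_ite, mul_one, mul_zero, Finset.sum_ite_eq',
      Finset.mem_univ, if_true]
  have hright (b : I) :
      (∑ c, m e c * (∑ p : I × I, t (op (σ' b d p.1 p.2)) * l c p.2 * l a p.1) * m b f) =
        ∑ x, t (op (τ b d x e)) * (l a x * m b f) := by
    simp only [Finset.mul_sum, Finset.sum_mul]
    rw [Finset.sum_comm]
    have (p : I × I) :
        (∑ c, m e c * (t (op (σ' b d p.1 p.2)) * l c p.2 * l a p.1) * m b f) =
          t (op ((S e).symm (σ' b d p.1 p.2))) * (if e = p.2 then 1 else 0) *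
            (l a p.1 * m b f) := by
      rw [← hml, Finset.mul_sum, Finset.sum_mul]
      refine Finset.sum_congr rfl fun c _ => ?_
      rw [← mul_assoc (t _) (m e c), htm, RingEquiv.apply_symm_apply]
      simp only [mul_assoc]
    simp only [this, Fintype.sum_prod_type, mul_ite, ite_mul, mul_one, mul_zero, zero_mul,
      Finset.sum_ite_eq, Finset.mem_univ, if_true]
    simp only [← hτ, RingEquiv.symm_apply_apply]
  simp only [hleft, hright] at key
  rw [Fintype.sum_prod_type, key, Fintype.sum_prod_type_right]

/-- The exchange relation with the coefficients moved to the other sides by the inverse `i`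
of `τ`. -/
theorem exchange_inverse_s14 (hst : ∀ f g, Commute (s f) (t (op g)))
    (hiτ : ∀ w x y z, (∑ p : I × I, i w p.1 z p.2 * τ p.2 y p.1 x) =
      if w = x ∧ y = z then 1 else 0)
    (hτi : ∀ w x y z, (∑ p : I × I, τ w p.1 z p.2 * i p.2 y p.1 x) =
      if w = x ∧ y = z then 1 else 0)
    (hex : ∀ a d e f, (∑ p : I × I, s (τ f p.2 a p.1) * (m e p.1 * l p.2 d)) =
      ∑ p : I × I, t (op (τ p.2 d p.1 e)) * (l a p.1 * m p.2 f)) (p q w z : I) :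
    (∑ v : I × I, t (op (i v.2 p v.1 q)) * (m v.2 w * l z v.1)) =
      ∑ v : I × I, s (i w v.1 z v.2) * (l v.1 p * m q v.2) := by
  have hml (e d : I) : m e w * l z d = ∑ v : I × I, s (i w v.1 z v.2) *
      ∑ r : I × I, t (op (τ r.2 d r.1 e)) * (l v.1 r.1 * m r.2 v.2) := by
    simp only [← hex, Finset.mul_sum]
    rw [Finset.sum_comm]
    simp only [← mul_assoc (s _) (s _), ← map_mul, ← Finset.sum_mul, ← map_sum, hiτ]
    rw [Finset.sum_eq_single (w, z)]
    · simp
    · rintro ⟨c, y⟩ - hne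
      rw [if_neg, map_zero, zero_mul]
      rintro ⟨rfl, rfl⟩
      exact hne rfl
    · simp
  simp only [hml, Finset.mul_sum]
  rw [Finset.sum_comm]
  refine Finset.sum_congr rfl fun v _ => ?_
  rw [Finset.sum_comm]
  have (r u : I × I) : t (op (i u.2 p u.1 q)) * (s (i w v.1 z v.2) *
      (t (op (τ r.2 u.1 r.1 u.2)) * (l v.1 r.1 * m r.2 v.2))) =
      s (i w v.1 z v.2) *
        (t (op (τ r.2 u.1 r.1 u.2 * i u.2 p u.1 q)) * (l v.1 r.1 * m r.2 v.2)) := by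
    rw [← mul_assoc, ← (hst _ _).eq, op_mul, map_mul]
    simp only [mul_assoc]
  simp only [this, ← Finset.mul_sum, ← Finset.sum_mul, ← map_sum, ← Finset.op_sum, hτi]
  congr 1
  rw [Finset.sum_eq_single (p, q)]
  · simp
  · rintro ⟨x, b⟩ - hne
    rw [if_neg, op_zero, map_zero, zero_mul]
    rintro ⟨rfl, rfl⟩
    exact hne rfl
  · simp

/-- Contracting `exchange_inverse` along `p = q`. -/
theorem exchange_contract_left (hlm : ∀ a b, ∑ c, l a c * m c b = if a = b then 1 else 0)
    (hF : ∀ p q w z, (∑ v : I × I, t (op (i v.2 p v.1 q)) * (m v.2 w * l z v.1)) =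
      ∑ v : I × I, s (i w v.1 z v.2) * (l v.1 p * m q v.2)) (w z : I) :
    (∑ v : I × I, t (op (∑ u, i v.2 u v.1 u)) * (m v.2 w * l z v.1)) =
      s (∑ u, i w u z u) := by
  simp only [Finset.op_sum, map_sum, Finset.sum_mul]
  rw [Finset.sum_comm]
  simp only [hF]
  rw [Finset.sum_comm]
  simp only [← Finset.mul_sum, hlm, mul_ite, mul_one, mul_zero, Fintype.sum_prod_type,
    Finset.sum_ite_eq, Finset.mem_univ, if_true]

/-- Contracting `exchange_inverse` along `w = z`. -/
theorem exchange_contract_right (hml : ∀ a b, ∑ c, m a c * l c b = if a = b then 1 else 0)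
    (hF : ∀ p q w z, (∑ v : I × I, t (op (i v.2 p v.1 q)) * (m v.2 w * l z v.1)) =
      ∑ v : I × I, s (i w v.1 z v.2) * (l v.1 p * m q v.2)) (p q : I) :
    (∑ v : I × I, s (∑ u, i u v.1 u v.2) * (l v.1 p * m q v.2)) =
      t (op (∑ u, i u p u q)) := by
  simp only [Finset.op_sum, map_sum, Finset.sum_mul]
  rw [Finset.sum_comm]
  simp only [← hF]
  rw [Finset.sum_comm]
  simp only [← Finset.mul_sum, hml, mul_ite, mul_one, mul_zero, Fintype.sum_prod_type,
    Finset.sum_ite_eq', Finset.mem_univ, if_true]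

/-- If the transpose of `l` has the left inverse `y`, and the contraction `W` of the inverse `i`
satisfies `exchange_contract_right`, then `y` is a two-sided inverse of the transpose of `l`. -/
theorem transpose_right_inverse {W K : I → I → R} {y : I → I → A}
    (hst : ∀ f g, Commute (s f) (t (op g)))
    (hsl : ∀ f a b, s (S a f) * l a b = l a b * s f)
    (htl : ∀ f a b, t (op (S b f)) * l a b = l a b * t (op f))
    (htm : ∀ f a b, t (op f) * m a b = m a b * t (op (S a f)))
    (hW : ∀ p q, (∑ v : I × I, s (W v.2 v.1) * (l v.1 p * m q v.2)) = t (op (W q p)))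
    (hK : ∀ a c, (∑ b, (S a).symm (W b a) * K b c) = if a = c then 1 else 0)
    (hy : ∀ a b, (∑ c, y c b * l a c) = if a = b then 1 else 0) (a b : I) :
    (∑ c, l c b * y a c) = if a = b then 1 else 0 := by
  have hW' (p q : I) : t (op (W q p)) =
      ∑ a, l a p * ∑ f, s ((S a).symm (W f a)) * m q f := by
    rw [← hW, Fintype.sum_prod_type]
    refine Finset.sum_congr rfl fun a _ => ?_
    rw [Finset.mul_sum]
    refine Finset.sum_congr rfl fun f _ => ?_
    rw [← mul_assoc (l a p), ← hsl, RingEquiv.apply_symm_apply, mul_assoc]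
  have hcomm (p q : I) (f : R) :
      t (op (S p f)) * t (op (W q p)) = t (op (W q p)) * t (op (S q f)) := by
    rw [hW', Finset.mul_sum, Finset.sum_mul]
    refine Finset.sum_congr rfl fun a _ => ?_
    rw [← mul_assoc, htl, mul_assoc, mul_assoc, Finset.mul_sum, Finset.sum_mul]
    congr 1
    refine Finset.sum_congr rfl fun r _ => ?_
    rw [← mul_assoc, ← (hst _ _).eq, mul_assoc, htm, mul_assoc]
  have hWK (p r : I) :
      (∑ q, t (op (W q p)) * t (op (S q (K q r)))) = if p = r then 1 else 0 := by
    have := congrArg (fun x => t (op (S p x))) (hK p r)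
    simp only [map_sum, map_mul, RingEquiv.apply_symm_apply, Finset.op_sum, op_mul, hcomm] at this
    rw [this]
    split_ifs <;> simp
  let lt : Matrix I I A := Matrix.of fun b c => l c b
  let yt : Matrix I I A := Matrix.of fun b c => y c b
  let Z : Matrix I I A := Matrix.of fun a q => ∑ f, s ((S a).symm (W f a)) * m q f
  let V : Matrix I I A := Matrix.of fun q r => t (op (S q (K q r)))
  have hleft : yt * lt = 1 := by
    ext b a
    simp only [yt, lt, Matrix.mul_apply, Matrix.of_apply, hy, Matrix.one_apply, eq_comm]
  have hright : lt * (Z * V) = 1 := by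
    rw [← mul_assoc]
    ext p r
    simp only [lt, Z, V, Matrix.mul_apply, Matrix.of_apply, ← hW', hWK, Matrix.one_apply]
  have h := congrFun (congrFun ((left_inv_eq_right_inv hleft hright) ▸ hright) b) a
  simpa only [yt, lt, Matrix.mul_apply, Matrix.of_apply, Matrix.one_apply, eq_comm] using h

end ExchangeRelations

section Quotient

variable {k L X G deg T σ}

theorem mkA_eq_of_sub_mem {x y : FreeAlgebra k (Gen k L X)}
    (h : x - y ∈ relSet k L X G deg T σ) : mkA k L X G deg T σ x = mkA k L X G deg T σ y := by
  refine (RingCon.eq _).2 ?_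
  have : x - y ∈ Isig k L X G deg T σ := TwoSidedIdeal.subset_span h
  exact ((TwoSidedIdeal.rel_iff _ _ _).2 this)

variable (k L X G deg T σ)

/-- The ring homomorphism `L ⊗[k] Lᵐᵒᵖ → A_σ`. -/
def tensorHom : L ⊗[k] Lᵐᵒᵖ →+* Asig k L X G deg T σ :=
  RingHom.mk'
    { toFun := fun ξ => mkA k L X G deg T σ (iT k L X ξ)
      map_one' := by
        rw [← map_one (mkA k L X G deg T σ)]
        refine (mkA_eq_of_sub_mem ?_).symm
        unfold relSet
        simp only [Set.mem_ofPred_eq, or_true]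
      map_mul' := fun ξ ξ' => by
        rw [← map_mul]
        exact (mkA_eq_of_sub_mem (Or.inr (Or.inr (Or.inl ⟨ξ, ξ', rfl⟩)))).symm }
    fun ξ ξ' => by
      change mkA k L X G deg T σ _ = mkA k L X G deg T σ _ + mkA k L X G deg T σ _
      rw [← map_add]
      exact (mkA_eq_of_sub_mem (Or.inl ⟨ξ, ξ', rfl⟩)).symm

/-- `f ↦ f ⊗ 1 + I_σ`. -/
def sourceHom : L →+* Asig k L X G deg T σ :=
  (tensorHom k L X G deg T σ).comp
    (Algebra.TensorProduct.includeLeft (R := k) (S := k) (A := L) (B := Lᵐᵒᵖ)).toRingHom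

/-- `op f ↦ 1 ⊗ f + I_σ`. -/
def targetHom : Lᵐᵒᵖ →+* Asig k L X G deg T σ :=
  (tensorHom k L X G deg T σ).comp
    (Algebra.TensorProduct.includeRight (R := k) (A := L) (B := Lᵐᵒᵖ)).toRingHom

variable {k L X G deg T σ}

theorem mkA_sE (f : L) :
    mkA k L X G deg T σ (iT k L X (sE k L f)) = sourceHom k L X G deg T σ f := rfl

theorem mkA_tE (f : L) :
    mkA k L X G deg T σ (iT k L X (tE k L f)) = targetHom k L X G deg T σ (op f) := rfl

theorem mkA_tmul (f g : L) : mkA k L X G deg T σ (iT k L X (f ⊗ₜ[k] op g)) =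
    sourceHom k L X G deg T σ f * targetHom k L X G deg T σ (op g) := by
  change tensorHom k L X G deg T σ _ =
    tensorHom k L X G deg T σ (f ⊗ₜ 1) * tensorHom k L X G deg T σ (1 ⊗ₜ op g)
  rw [← map_mul, Algebra.TensorProduct.tmul_mul_tmul, mul_one, one_mul]

theorem sourceHom_commute_targetHom (f g : L) :
    Commute (sourceHom k L X G deg T σ f) (targetHom k L X G deg T σ (op g)) := by
  change tensorHom k L X G deg T σ (f ⊗ₜ 1) * tensorHom k L X G deg T σ (1 ⊗ₜ op g) =
    tensorHom k L X G deg T σ (1 ⊗ₜ op g) * tensorHom k L X G deg T σ (f ⊗ₜ 1)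
  rw [← map_mul, ← map_mul, Algebra.TensorProduct.tmul_mul_tmul,
    Algebra.TensorProduct.tmul_mul_tmul, mul_one, one_mul, mul_one, one_mul]

end Quotient

/-- Under conditions (1)–(5), the elements
`y_{ab} = Σ_{c,d} (Q'⁻¹_{db} ⊗ Q'_{ac}) (L⁻¹)_{cd} + I_σ` satisfy
`Σ_c L_{cb} y_{ac} = δ_{ab} 1 = Σ_c y_{cb} L_{ac}`. -/
theorem y_witness_formula (hT : ∀ (α : G) (f : L), T α (T α⁻¹ f) = f)
    (h41 : ∀ a b c d : X,
      T (deg a)⁻¹ (T (deg c)⁻¹ (σ b d a c)) = T (deg b)⁻¹ (T (deg d)⁻¹ (σ b d a c)))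
    (isg : X → X → X → X → L)
    (h1a : ∀ w x' y z : X,
      (∑ a : X, ∑ b : X, isg w a z b * T (deg x')⁻¹ (σ b y a x')) =
        if w = x' ∧ y = z then 1 else 0)
    (h1b : ∀ w x' y z : X,
      (∑ a : X, ∑ b : X, T (deg b)⁻¹ (σ w a z b) * isg b y a x') =
        if w = x' ∧ y = z then 1 else 0)
    (Q Qinv : X → X → L)
    (hQ : ∀ a b : X, Q a b = ∑ u : X, isg u b u a)
    (hQinv : ∀ a c : X, (∑ b : X, Q a b * Qinv b c) = if a = c then 1 else 0)
    (Q' Q'inv : X → X → L)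
    (hQ' : ∀ a b : X, Q' a b = ∑ u : X, isg b u a u)
    (hQ'inv : ∀ a c : X, (∑ b : X, Q'inv b c * Q' a b) = if a = c then 1 else 0)
    (Q'' Q''inv : X → X → L)
    (hQ'' : ∀ a b : X, Q'' a b = ∑ u : X, T (deg b) (isg b u a u))
    (hQ''inv : ∀ a c : X, (∑ b : X, Q''inv a b * Q'' b c) = if a = c then 1 else 0)
    (Q''' Q'''inv : X → X → L)
    (hQ''' : ∀ a b : X, Q''' a b = ∑ u : X, T (deg a)⁻¹ (isg u a u b))
    (hQ'''inv : ∀ a c : X, (∑ b : X, Q''' a b * Q'''inv b c) = if a = c then 1 else 0) :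
    ∀ a b : X,
      (∑ c : X, mkA k L X G deg T σ (iL k L X c b) *
        mkA k L X G deg T σ (∑ c' : X, ∑ d : X,
          iT k L X (Q'inv d c ⊗ₜ[k] op (Q' a c')) * iLi k L X c' d)) =
        (if a = b then 1 else 0) ∧
      (∑ c : X, mkA k L X G deg T σ (∑ c' : X, ∑ d : X,
          iT k L X (Q'inv d b ⊗ₜ[k] op (Q' c c')) * iLi k L X c' d) *
        mkA k L X G deg T σ (iL k L X a c)) = (if a = b then 1 else 0) := by
  let s := sourceHom k L X G deg T σ
  let t := targetHom k L X G deg T σ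
  let l : X → X → Asig k L X G deg T σ := fun a b => mkA k L X G deg T σ (iL k L X a b)
  let m : X → X → Asig k L X G deg T σ := fun a b => mkA k L X G deg T σ (iLi k L X a b)
  let S : X → L ≃+* L := fun a => (T (deg a)).toRingEquiv
  have hST (a : X) (f : L) : S a (T (deg a)⁻¹ f) = f := hT _ _
  have hSsymm (a : X) (f : L) : (S a).symm f = T (deg a)⁻¹ f := by
    rw [RingEquiv.symm_apply_eq, hST]
  have hst (f g : L) : Commute (s f) (t (op g)) := sourceHom_commute_targetHom f g
  have hlm (a b : X) : ∑ c, l a c * m c b = if a = b then 1 else 0 := by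
    have := mkA_eq_of_sub_mem (G := G) (deg := deg) (T := T) (σ := σ)
      (Or.inr (Or.inr (Or.inr (Or.inl ⟨a, b, rfl⟩))))
    simpa only [map_sum, map_mul, apply_ite (mkA k L X G deg T σ), map_one, map_zero] using this
  have hml (a b : X) : ∑ c, m a c * l c b = if a = b then 1 else 0 := by
    have := mkA_eq_of_sub_mem (G := G) (deg := deg) (T := T) (σ := σ)
      (Or.inr (Or.inr (Or.inr (Or.inr (Or.inl ⟨a, b, rfl⟩)))))
    simpa only [map_sum, map_mul, apply_ite (mkA k L X G deg T σ), map_one, map_zero] using this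
  have hsl (f : L) (a b : X) : s (S a f) * l a b = l a b * s f := by
    have := mkA_eq_of_sub_mem (G := G) (deg := deg) (T := T) (σ := σ)
      (Or.inr (Or.inr (Or.inr (Or.inr (Or.inr (Or.inl ⟨f, a, b, rfl⟩))))))
    simp only [map_mul, mkA_sE] at this
    exact this
  have htl (f : L) (a b : X) : t (op (S b f)) * l a b = l a b * t (op f) := by
    have := mkA_eq_of_sub_mem (G := G) (deg := deg) (T := T) (σ := σ)
      (Or.inr (Or.inr (Or.inr (Or.inr (Or.inr (Or.inr (Or.inl ⟨f, a, b, rfl⟩)))))))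
    simp only [map_mul, mkA_tE] at this
    exact this
  have hsm (f : L) (a b : X) : s f * m a b = m a b * s (S b f) := by
    have := mkA_eq_of_sub_mem (G := G) (deg := deg) (T := T) (σ := σ)
      (Or.inr (Or.inr (Or.inr (Or.inr (Or.inr (Or.inr (Or.inr (Or.inl ⟨f, a, b, rfl⟩))))))))
    simp only [map_mul, mkA_sE] at this
    exact this
  have htm (f : L) (a b : X) : t (op f) * m a b = m a b * t (op (S a f)) := by
    have := mkA_eq_of_sub_mem (G := G) (deg := deg) (T := T) (σ := σ)
      (Or.inr (Or.inr (Or.inr (Or.inr (Or.inr (Or.inr (Or.inr (Or.inr (Or.inl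
        ⟨f, a, b, rfl⟩)))))))))
    simp only [map_mul, mkA_tE] at this
    exact this
  have hrll (a b c d : X) : (∑ p : X × X, s (σ p.1 p.2 a c) * l p.2 d * l p.1 b) =
      ∑ p : X × X, t (op (σ b d p.1 p.2)) * l c p.2 * l a p.1 := by
    have := mkA_eq_of_sub_mem (G := G) (deg := deg) (T := T) (σ := σ)
      (Or.inr (Or.inr (Or.inr (Or.inr (Or.inr (Or.inr (Or.inr (Or.inr (Or.inr (Or.inl
        ⟨a, b, c, d, rfl⟩))))))))))
    simpa only [map_sum, map_mul, mkA_sE, mkA_tE, Fintype.sum_prod_type] using this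
  have hF := exchange_inverse_s14 (i := isg) hst
    (fun w x y z => by rw [Fintype.sum_prod_type, ← h1a])
    (fun w x y z => by rw [Fintype.sum_prod_type, ← h1b])
    (exchange_of_rll hlm hml hsm htm (fun _ _ _ _ => hST _ _) hrll)
  have hy (a b : X) : (∑ c : X, mkA k L X G deg T σ (∑ c' : X, ∑ d : X,
      iT k L X (Q'inv d b ⊗ₜ[k] op (Q' c c')) * iLi k L X c' d) * l a c) =
      if a = b then 1 else 0 := by
    have hQs (d : X) : s (Q' a d) =
        ∑ c : X, ∑ c' : X, t (op (Q' c c')) * (m c' d * l a c) := by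
      rw [hQ', ← exchange_contract_left hlm hF, Fintype.sum_prod_type]
      simp only [hQ']
    have h := congrArg s (hQ'inv a b)
    simp only [map_sum, map_mul, hQs, apply_ite s, map_one, map_zero, Finset.mul_sum] at h
    rw [← h, Finset.sum_comm]
    simp only [map_sum, map_mul, mkA_tmul, Finset.sum_mul]
    refine Finset.sum_congr rfl fun c _ => ?_
    rw [Finset.sum_comm]
    simp only [s, t, l, m, mul_assoc]
  refine fun a b => ⟨transpose_right_inverse (W := Q) (K := Q'''inv)
    (y := fun a b => mkA k L X G deg T σ (∑ c' : X, ∑ d : X,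
      iT k L X (Q'inv d b ⊗ₜ[k] op (Q' a c')) * iLi k L X c' d))
    hst hsl htl htm (fun p q => ?_) (fun a c => ?_) hy a b, hy a b⟩
  · rw [hQ, ← exchange_contract_right hml hF]
    simp only [hQ]
  · simp only [← hQ'''inv, hQ''', hQ, hSsymm, map_sum]

end
end
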